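/- The following equivalences are derivable from the axioms of Table 2 whenever both sides are well-typed (where − is a placeholder for x, *, or ⟨x,y⟩): (i) Δ,x:A ⊢ let y^A = x^A in M ≈ M[x/y] : B; (ii) !Δ ⊢ let x^{!C} = V in λy.M ≈ λ^{n+1}y. let x^{!C} = V in M : !^{n+1}(A⊸B); (iii) Δ ⊢ ⟨V, let − = M in N⟩ ≈ let − = M in ⟨V,N⟩ : !ⁿ(A⊗B); (iv) Δ ⊢ ⟨let − = M in N, V⟩ ≈ let − = M in ⟨N,V⟩ : !ⁿ(A⊗B); (v) Δ ⊢ V(let − = M in N) ≈ let − = M in VN : B; (vi) Δ ⊢ (let − = M in N)V ≈ let − = M in NV : B. -/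

import Mathlib

/- The call-by-value linear lambda calculus of Selinger-Valiron:
   types, subtyping, indexed terms, values, erasure, contexts, typing rules. -/

namespace QLam

/-- Types: A,B ::= α | A ⊸ B | A ⊗ B | ⊤ | !A -/
inductive Ty : Type where
  | tconst : ℕ → Ty
  | arrow : Ty → Ty → Ty
  | tensor : Ty → Ty → Ty
  | unit : Ty
  | bang : Ty → Ty
deriving DecidableEq

/-- `bangN n A` is `!ⁿA`. -/
def bangN : ℕ → Ty → Ty
  | 0, A => A
  | n + 1, A => Ty.bang (bangN n A)

/-- The subtyping relation `A <: B`. -/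
inductive Sub : Ty → Ty → Prop where
  | tconst (n m a : ℕ) : (m = 0 ∨ 1 ≤ n) →
      Sub (bangN n (Ty.tconst a)) (bangN m (Ty.tconst a))
  | unit (n m : ℕ) : (m = 0 ∨ 1 ≤ n) →
      Sub (bangN n Ty.unit) (bangN m Ty.unit)
  | arrow (n m : ℕ) (A A' B B' : Ty) : (m = 0 ∨ 1 ≤ n) → Sub A A' → Sub B B' →
      Sub (bangN n (Ty.arrow A' B)) (bangN m (Ty.arrow A B'))
  | tensor (n m : ℕ) (A A' B B' : Ty) : (m = 0 ∨ 1 ≤ n) → Sub A A' → Sub B B' →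
      Sub (bangN n (Ty.tensor A B)) (bangN m (Ty.tensor A' B'))

/-- Indexed terms.  `letv x A M N` is `let x^A = M in N` (the abbreviation of
    `(λ⁰x^A.N) M`), `letPair n x A y B M N` is `let ⟨x^A,y^B⟩ⁿ = M in N`,
    `letUnit M N` is `let ∗ = M in N`, `star n` is `∗ⁿ`, `lam n x A M` is `λⁿx^A.M`. -/
inductive Tm : Type where
  | var : ℕ → Ty → Tm
  | cst : ℕ → Ty → Tm
  | star : ℕ → Tm
  | lam : ℕ → ℕ → Ty → Tm → Tm
  | app : Tm → Tm → Tm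
  | pair : ℕ → Tm → Tm → Tm
  | letv : ℕ → Ty → Tm → Tm → Tm
  | letPair : ℕ → ℕ → Ty → ℕ → Ty → Tm → Tm → Tm
  | letUnit : Tm → Tm → Tm
deriving DecidableEq

/-- Core values U ::= x^A | c^A | ∗ⁿ | λⁿx^A.M -/
inductive IsCoreValue : Tm → Prop where
  | var (x : ℕ) (A : Ty) : IsCoreValue (.var x A)
  | cst (c : ℕ) (A : Ty) : IsCoreValue (.cst c A)
  | star (n : ℕ) : IsCoreValue (.star n)
  | lam (n x : ℕ) (A : Ty) (M : Tm) : IsCoreValue (.lam n x A M)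

/-- Values V,W ::= U | ⟨V,W⟩ⁿ | let x^A = V in W | let ⟨x^A,y^B⟩ⁿ = V in W | let ∗ = V in W -/
inductive IsValue : Tm → Prop where
  | core {U : Tm} : IsCoreValue U → IsValue U
  | pair {V W : Tm} (n : ℕ) : IsValue V → IsValue W → IsValue (.pair n V W)
  | letv {V W : Tm} (x : ℕ) (A : Ty) : IsValue V → IsValue W → IsValue (.letv x A V W)
  | letPair {V W : Tm} (n x : ℕ) (A : Ty) (y : ℕ) (B : Ty) :
      IsValue V → IsValue W → IsValue (.letPair n x A y B V W)
  | letUnit {V W : Tm} : IsValue V → IsValue W → IsValue (.letUnit V W)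

/-- Untyped (pure) terms. -/
inductive PTm : Type where
  | var : ℕ → PTm
  | cst : ℕ → PTm
  | star : PTm
  | lam : ℕ → PTm → PTm
  | app : PTm → PTm → PTm
  | pair : PTm → PTm → PTm
  | letv : ℕ → PTm → PTm → PTm
  | letPair : ℕ → ℕ → PTm → PTm → PTm
  | letUnit : PTm → PTm → PTm
deriving DecidableEq

/-- The erasure operation, deleting all type and integer annotations. -/
def erase : Tm → PTm
  | .var x _ => .var x
  | .cst c _ => .cst c
  | .star _ => .star
  | .lam _ x _ M => .lam x (erase M)
  | .app M N => .app (erase M) (erase N)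
  | .pair _ M N => .pair (erase M) (erase N)
  | .letv x _ M N => .letv x (erase M) (erase N)
  | .letPair _ x _ y _ M N => .letPair x y (erase M) (erase N)
  | .letUnit M N => .letUnit (erase M) (erase N)

/-- `FreeAt x A M` : the term `M` has a free instance `x^A` of the variable `x`. -/
inductive FreeAt (x : ℕ) : Ty → Tm → Prop where
  | var (A : Ty) : FreeAt x A (.var x A)
  | lam {A : Ty} {M : Tm} (n y : ℕ) (B : Ty) : y ≠ x → FreeAt x A M →
      FreeAt x A (.lam n y B M)
  | appL {A : Ty} {M : Tm} (N : Tm) : FreeAt x A M → FreeAt x A (.app M N)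
  | appR {A : Ty} {N : Tm} (M : Tm) : FreeAt x A N → FreeAt x A (.app M N)
  | pairL {A : Ty} {M : Tm} (n : ℕ) (N : Tm) : FreeAt x A M → FreeAt x A (.pair n M N)
  | pairR {A : Ty} {N : Tm} (n : ℕ) (M : Tm) : FreeAt x A N → FreeAt x A (.pair n M N)
  | letvL {A : Ty} {M : Tm} (y : ℕ) (B : Ty) (N : Tm) : FreeAt x A M →
      FreeAt x A (.letv y B M N)
  | letvR {A : Ty} {N : Tm} (y : ℕ) (B : Ty) (M : Tm) : y ≠ x → FreeAt x A N →
      FreeAt x A (.letv y B M N)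
  | letPairL {A : Ty} {M : Tm} (n y : ℕ) (B : Ty) (z : ℕ) (C : Ty) (N : Tm) :
      FreeAt x A M → FreeAt x A (.letPair n y B z C M N)
  | letPairR {A : Ty} {N : Tm} (n y : ℕ) (B : Ty) (z : ℕ) (C : Ty) (M : Tm) :
      y ≠ x → z ≠ x → FreeAt x A N → FreeAt x A (.letPair n y B z C M N)
  | letUnitL {A : Ty} {M : Tm} (N : Tm) : FreeAt x A M → FreeAt x A (.letUnit M N)
  | letUnitR {A : Ty} {N : Tm} (M : Tm) : FreeAt x A N → FreeAt x A (.letUnit M N)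

/-- `x` occurs free in `M`. -/
def Free (x : ℕ) (M : Tm) : Prop := ∃ A, FreeAt x A M

/-- `x` occurs as a bound variable (binder) somewhere in `M`. -/
inductive BoundIn (x : ℕ) : Tm → Prop where
  | lamB (n : ℕ) (A : Ty) (M : Tm) : BoundIn x (.lam n x A M)
  | lamI {M : Tm} (n y : ℕ) (A : Ty) : BoundIn x M → BoundIn x (.lam n y A M)
  | appL {M : Tm} (N : Tm) : BoundIn x M → BoundIn x (.app M N)
  | appR {N : Tm} (M : Tm) : BoundIn x N → BoundIn x (.app M N)
  | pairL {M : Tm} (n : ℕ) (N : Tm) : BoundIn x M → BoundIn x (.pair n M N)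
  | pairR {N : Tm} (n : ℕ) (M : Tm) : BoundIn x N → BoundIn x (.pair n M N)
  | letvB (A : Ty) (M N : Tm) : BoundIn x (.letv x A M N)
  | letvL {M : Tm} (y : ℕ) (A : Ty) (N : Tm) : BoundIn x M → BoundIn x (.letv y A M N)
  | letvR {N : Tm} (y : ℕ) (A : Ty) (M : Tm) : BoundIn x N → BoundIn x (.letv y A M N)
  | letPairB1 (n : ℕ) (A : Ty) (z : ℕ) (B : Ty) (M N : Tm) :
      BoundIn x (.letPair n x A z B M N)
  | letPairB2 (n y : ℕ) (A : Ty) (B : Ty) (M N : Tm) :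
      BoundIn x (.letPair n y A x B M N)
  | letPairL {M : Tm} (n y : ℕ) (A : Ty) (z : ℕ) (B : Ty) (N : Tm) :
      BoundIn x M → BoundIn x (.letPair n y A z B M N)
  | letPairR {N : Tm} (n y : ℕ) (A : Ty) (z : ℕ) (B : Ty) (M : Tm) :
      BoundIn x N → BoundIn x (.letPair n y A z B M N)
  | letUnitL {M : Tm} (N : Tm) : BoundIn x M → BoundIn x (.letUnit M N)
  | letUnitR {N : Tm} (M : Tm) : BoundIn x N → BoundIn x (.letUnit M N)

/-- Capture-avoiding (up to the usual variable conventions) substitution on untyped terms. -/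
def psubst (x : ℕ) (V : PTm) : PTm → PTm
  | .var y => if y = x then V else .var y
  | .cst c => .cst c
  | .star => .star
  | .lam y M => if y = x then .lam y M else .lam y (psubst x V M)
  | .app M N => .app (psubst x V M) (psubst x V N)
  | .pair M N => .pair (psubst x V M) (psubst x V N)
  | .letv y M N => .letv y (psubst x V M) (if y = x then N else psubst x V N)
  | .letPair y z M N =>
      .letPair y z (psubst x V M) (if y = x ∨ z = x then N else psubst x V N)
  | .letUnit M N => .letUnit (psubst x V M) (psubst x V N)

/-- Typing contexts: finite partial assignments of types to variables. -/
abbrev Ctx : Type := ℕ → Option Ty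

/-- The empty context. -/
def emptyC : Ctx := fun _ => none

/-- Context extension `Δ, x:A`. -/
def extC (Δ : Ctx) (x : ℕ) (A : Ty) : Ctx := fun y => if y = x then some A else Δ y

/-- Disjointness of contexts. -/
def DisjC (Γ₁ Γ₂ : Ctx) : Prop := ∀ x, Γ₁ x = none ∨ Γ₂ x = none

/-- Union of contexts (left-biased; used on disjoint contexts). -/
def unionC (Γ₁ Γ₂ : Ctx) : Ctx := fun x => (Γ₁ x).orElse (fun _ => Γ₂ x)

/-- `Δ` is of the form `!Δ'`: every type occurring in `Δ` is of the form `!B`. -/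
def IsBangC (Δ : Ctx) : Prop := ∀ x A, Δ x = some A → ∃ B, A = Ty.bang B

/-- `!Δ`, obtained from `Δ` by prefixing every type with `!`. -/
def bangifyC (Δ : Ctx) : Ctx := fun x => (Δ x).map Ty.bang

/-- The typing rules of Table 1.  The parameter `cty` assigns to each constant `c`
    the type `A_c`; the type assigned to `c` is `!A_c`. -/
inductive Typing (cty : ℕ → Ty) : Ctx → Tm → Ty → Prop where
  | var {Δ : Ctx} {x : ℕ} {A B : Ty} :
      IsBangC Δ → Δ x = none → Sub A B →
      Typing cty (extC Δ x A) (.var x B) B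
  | cst {Δ : Ctx} {c : ℕ} {B : Ty} :
      IsBangC Δ → Sub (.bang (cty c)) B →
      Typing cty Δ (.cst c B) B
  | star {Δ : Ctx} {n : ℕ} :
      IsBangC Δ →
      Typing cty Δ (.star n) (bangN n .unit)
  | lam0 {Δ : Ctx} {x : ℕ} {A : Ty} {M : Tm} {B : Ty} :
      Δ x = none → Typing cty (extC Δ x A) M B →
      Typing cty Δ (.lam 0 x A M) (.arrow A B)
  | lamS {Δ : Ctx} {n x : ℕ} {A : Ty} {M : Tm} {B : Ty} :
      IsBangC Δ → Δ x = none → Typing cty (extC Δ x A) M B →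
      Typing cty Δ (.lam (n + 1) x A M) (bangN (n + 1) (.arrow A B))
  | app {Δ Γ₁ Γ₂ : Ctx} {M N : Tm} {A B : Ty} :
      IsBangC Δ → DisjC Γ₁ Γ₂ → DisjC Γ₁ Δ → DisjC Γ₂ Δ →
      Typing cty (unionC Γ₁ Δ) M (.arrow A B) →
      Typing cty (unionC Γ₂ Δ) N A →
      Typing cty (unionC Γ₁ (unionC Γ₂ Δ)) (.app M N) B
  | pair {Δ Γ₁ Γ₂ : Ctx} {n : ℕ} {M₁ M₂ : Tm} {A₁ A₂ : Ty} :
      IsBangC Δ → DisjC Γ₁ Γ₂ → DisjC Γ₁ Δ → DisjC Γ₂ Δ →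
      Typing cty (unionC Γ₁ Δ) M₁ (bangN n A₁) →
      Typing cty (unionC Γ₂ Δ) M₂ (bangN n A₂) →
      Typing cty (unionC Γ₁ (unionC Γ₂ Δ)) (.pair n M₁ M₂) (bangN n (.tensor A₁ A₂))
  | letv {Δ Γ₁ Γ₂ : Ctx} {x : ℕ} {A : Ty} {M N : Tm} {B : Ty} :
      IsBangC Δ → DisjC Γ₁ Γ₂ → DisjC Γ₁ Δ → DisjC Γ₂ Δ →
      (unionC Γ₁ (unionC Γ₂ Δ)) x = none →
      Typing cty (unionC Γ₁ Δ) M A →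
      Typing cty (extC (unionC Γ₂ Δ) x A) N B →
      Typing cty (unionC Γ₁ (unionC Γ₂ Δ)) (.letv x A M N) B
  | letUnit {Δ Γ₁ Γ₂ : Ctx} {M N : Tm} {A : Ty} :
      IsBangC Δ → DisjC Γ₁ Γ₂ → DisjC Γ₁ Δ → DisjC Γ₂ Δ →
      Typing cty (unionC Γ₁ Δ) M .unit →
      Typing cty (unionC Γ₂ Δ) N A →
      Typing cty (unionC Γ₁ (unionC Γ₂ Δ)) (.letUnit M N) A
  | letPair {Δ Γ₁ Γ₂ : Ctx} {n x₁ : ℕ} {A₁ : Ty} {x₂ : ℕ} {A₂ : Ty} {M N : Tm} {A : Ty} :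
      IsBangC Δ → DisjC Γ₁ Γ₂ → DisjC Γ₁ Δ → DisjC Γ₂ Δ →
      x₁ ≠ x₂ →
      (unionC Γ₁ (unionC Γ₂ Δ)) x₁ = none →
      (unionC Γ₁ (unionC Γ₂ Δ)) x₂ = none →
      Typing cty (unionC Γ₁ Δ) M (bangN n (.tensor A₁ A₂)) →
      Typing cty (extC (extC (unionC Γ₂ Δ) x₁ (bangN n A₁)) x₂ (bangN n A₂)) N A →
      Typing cty (unionC Γ₁ (unionC Γ₂ Δ)) (.letPair n x₁ A₁ x₂ A₂ M N) A

/-- Pointwise subtyping of contexts with the same variables: `Δ' <: Δ`. -/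
def SubCtx (Δ' Δ : Ctx) : Prop :=
  (∀ x, Δ x = none → Δ' x = none) ∧
  (∀ x A, Δ x = some A → ∃ A', Δ' x = some A' ∧ Sub A' A)

end QLam

namespace QLam

/-- The three shapes of `let` patterns: the placeholder `−` stands for a variable `x`,
for `∗`, or for a pair `⟨x,y⟩`. -/
inductive LetPat : Type where
  | pvar (x : ℕ) (A : Ty)
  | punit
  | ppair (n x : ℕ) (A : Ty) (y : ℕ) (B : Ty)

/-- `mkLet p M N` is `let − = M in N` for the pattern `−` described by `p`. -/
def mkLet : LetPat → Tm → Tm → Tm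
  | .pvar x A, M, N => .letv x A M N
  | .punit, M, N => .letUnit M N
  | .ppair n x A y B, M, N => .letPair n x A y B M N

/-- Axiomatic equivalence `Δ ⊢ M ≈ M' : A`: the reflexive, symmetric, transitive and
congruence closure of the axioms of Table 2, each instance applying only when both
sides are well-typed.  The terms produced by canonical type casts and canonical
substitutions are characterized by their erasures. -/
inductive AxEq (cty : ℕ → Ty) : Ctx → Tm → Tm → Ty → Prop where
  /- equivalence -/
  | refl {Δ M A} : Typing cty Δ M A → AxEq cty Δ M M A
  | symm {Δ M N A} : AxEq cty Δ M N A → AxEq cty Δ N M A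
  | trans {Δ M N P A} : AxEq cty Δ M N A → AxEq cty Δ N P A → AxEq cty Δ M P A
  /- congruence -/
  | congLam {Δ' M M' A'} (n x : ℕ) (A : Ty) {Δ B} :
      AxEq cty Δ' M M' A' →
      Typing cty Δ (.lam n x A M) B → Typing cty Δ (.lam n x A M') B →
      AxEq cty Δ (.lam n x A M) (.lam n x A M') B
  | congApp {Δ₁ M M' T₁ Δ₂ N N' T₂ Δ B} :
      AxEq cty Δ₁ M M' T₁ → AxEq cty Δ₂ N N' T₂ →
      Typing cty Δ (.app M N) B → Typing cty Δ (.app M' N') B →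
      AxEq cty Δ (.app M N) (.app M' N') B
  | congPair (n : ℕ) {Δ₁ M M' T₁ Δ₂ N N' T₂ Δ B} :
      AxEq cty Δ₁ M M' T₁ → AxEq cty Δ₂ N N' T₂ →
      Typing cty Δ (.pair n M N) B → Typing cty Δ (.pair n M' N') B →
      AxEq cty Δ (.pair n M N) (.pair n M' N') B
  | congLetv (x : ℕ) (A : Ty) {Δ₁ M M' T₁ Δ₂ N N' T₂ Δ B} :
      AxEq cty Δ₁ M M' T₁ → AxEq cty Δ₂ N N' T₂ →
      Typing cty Δ (.letv x A M N) B → Typing cty Δ (.letv x A M' N') B →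
      AxEq cty Δ (.letv x A M N) (.letv x A M' N') B
  | congLetPair (n x : ℕ) (A : Ty) (y : ℕ) (B : Ty) {Δ₁ M M' T₁ Δ₂ N N' T₂ Δ C} :
      AxEq cty Δ₁ M M' T₁ → AxEq cty Δ₂ N N' T₂ →
      Typing cty Δ (.letPair n x A y B M N) C → Typing cty Δ (.letPair n x A y B M' N') C →
      AxEq cty Δ (.letPair n x A y B M N) (.letPair n x A y B M' N') C
  | congLetUnit {Δ₁ M M' T₁ Δ₂ N N' T₂ Δ B} :
      AxEq cty Δ₁ M M' T₁ → AxEq cty Δ₂ N N' T₂ →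
      Typing cty Δ (.letUnit M N) B → Typing cty Δ (.letUnit M' N') B →
      AxEq cty Δ (.letUnit M N) (.letUnit M' N') B
  /- β-rules -/
  | beta_letv {Δ x A V M S B} : IsValue V →
      Typing cty Δ (.letv x A V M) B → Typing cty Δ S B →
      erase S = psubst x (erase V) (erase M) →
      AxEq cty Δ (.letv x A V M) S B
  | beta_letPair {Δ n x A y B' V W M S B} : IsValue V → IsValue W →
      Typing cty Δ (.letPair n x A y B' (.pair n V W) M) B → Typing cty Δ S B →
      erase S = psubst y (erase W) (psubst x (erase V) (erase M)) →
      AxEq cty Δ (.letPair n x A y B' (.pair n V W) M) S B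
  | beta_letUnit {Δ M A} :
      Typing cty Δ (.letUnit (.star 0) M) A → Typing cty Δ M A →
      AxEq cty Δ (.letUnit (.star 0) M) M A
  /- η-rules -/
  | eta_lam {Δ n x A V V' B} : IsValue V → erase V' = erase V → ¬ Free x V →
      Typing cty Δ (.lam n x A (.app V' (.var x A))) (bangN n (.arrow A B)) →
      Typing cty Δ V (bangN n (.arrow A B)) →
      AxEq cty Δ (.lam n x A (.app V' (.var x A))) V (bangN n (.arrow A B))
  | eta_letv {Δ x A N} :
      Typing cty Δ (.letv x A N (.var x A)) A → Typing cty Δ N A →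
      AxEq cty Δ (.letv x A N (.var x A)) N A
  | eta_letPair {Δ n x A y B N} :
      Typing cty Δ (.letPair n x A y B N (.pair n (.var x (bangN n A)) (.var y (bangN n B))))
        (bangN n (.tensor A B)) →
      Typing cty Δ N (bangN n (.tensor A B)) →
      AxEq cty Δ (.letPair n x A y B N (.pair n (.var x (bangN n A)) (.var y (bangN n B)))) N
        (bangN n (.tensor A B))
  | eta_letUnit {Δ n N} :
      Typing cty Δ (.letUnit N (.star n)) (bangN n Ty.unit) →
      Typing cty Δ N (bangN n Ty.unit) →
      AxEq cty Δ (.letUnit N (.star n)) N (bangN n Ty.unit)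
  /- commutation rules -/
  | letassoc {Δ A} (p₁ p₂ : LetPat) (M N P : Tm) :
      Typing cty Δ (mkLet p₁ (mkLet p₂ M N) P) A →
      Typing cty Δ (mkLet p₂ M (mkLet p₁ N P)) A →
      AxEq cty Δ (mkLet p₁ (mkLet p₂ M N) P) (mkLet p₂ M (mkLet p₁ N P)) A
  | letcomm {Δ A} (p₁ p₂ : LetPat) (V W M : Tm) : IsValue V → IsValue W →
      Typing cty Δ (mkLet p₁ V (mkLet p₂ W M)) A →
      Typing cty Δ (mkLet p₂ W (mkLet p₁ V M)) A →
      AxEq cty Δ (mkLet p₁ V (mkLet p₂ W M)) (mkLet p₂ W (mkLet p₁ V M)) A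
  | letapp {Δ x A B y M N} :
      Typing cty Δ (.letv x (.arrow A B) M (.letv y A N (.app (.var x (.arrow A B)) (.var y A)))) B →
      Typing cty Δ (.app M N) B →
      AxEq cty Δ (.letv x (.arrow A B) M (.letv y A N (.app (.var x (.arrow A B)) (.var y A))))
        (.app M N) B
  | letlam {Δ x D V n y A M B} : IsValue V →
      Typing cty Δ (.letv x D V (.lam n y A M)) (bangN n (.arrow A B)) →
      Typing cty Δ (.lam n y A (.letv x D V M)) (bangN n (.arrow A B)) →
      AxEq cty Δ (.letv x D V (.lam n y A M)) (.lam n y A (.letv x D V M)) (bangN n (.arrow A B))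
  | lettens {Δ x A y B M N n C} :
      Typing cty Δ (.letv x A M (.letv y B N (.pair n (.var x A) (.var y B)))) C →
      Typing cty Δ (.pair n M N) C →
      AxEq cty Δ (.letv x A M (.letv y B N (.pair n (.var x A) (.var y B)))) (.pair n M N) C
  /- type cast rules: two indexations of the same shape with the same erasure and the
     same typing are equivalent -/
  | cast_app {Δ M₁ N₁ M₂ N₂ B} : erase M₁ = erase M₂ → erase N₁ = erase N₂ →
      Typing cty Δ (.app M₁ N₁) B → Typing cty Δ (.app M₂ N₂) B →
      AxEq cty Δ (.app M₁ N₁) (.app M₂ N₂) B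
  | cast_letPair {Δ n n' x A A₂ y B B₂ M M' N N' C} : erase M' = erase M → erase N' = erase N →
      Typing cty Δ (.letPair n' x A₂ y B₂ M' N') C → Typing cty Δ (.letPair n x A y B M N) C →
      AxEq cty Δ (.letPair n' x A₂ y B₂ M' N') (.letPair n x A y B M N) C
  | cast_letv {Δ x A A' M M' N N' C} : erase M' = erase M → erase N' = erase N →
      Typing cty Δ (.letv x A' M' N') C → Typing cty Δ (.letv x A M N) C →
      AxEq cty Δ (.letv x A' M' N') (.letv x A M N) C
  | cast_letUnit {Δ M M' N C} : erase M' = erase M →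
      Typing cty Δ (.letUnit M' N) C → Typing cty Δ (.letUnit M N) C →
      AxEq cty Δ (.letUnit M' N) (.letUnit M N) C

end QLam

namespace QLam

/-! ### Types -/

theorem Sub.refl (A : Ty) : Sub A A := by
  have key : ∀ A : Ty, ∀ n, Sub (bangN n A) (bangN n A) := by
    intro A
    induction A with
    | tconst a => exact fun n => .tconst n n a (by omega)
    | unit => exact fun n => .unit n n (by omega)
    | arrow A B ihA ihB =>
      exact fun n => .arrow n n A A B B (by omega) (ihA 0) (ihB 0)
    | tensor A B ihA ihB =>
      exact fun n => .tensor n n A A B B (by omega) (ihA 0) (ihB 0)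
    | bang A ih =>
      intro n
      have comm : ∀ n, bangN n (.bang A) = bangN (n + 1) A := by
        intro n
        induction n with
        | zero => rfl
        | succ n ihn => simp only [bangN] at ihn ⊢; rw [ihn]
      rw [comm]
      exact ih (n + 1)
  exact key A 0

theorem bangN_injective (n : ℕ) : Function.Injective (bangN n) := by
  induction n with
  | zero => exact fun _ _ h => h
  | succ n ih =>
    intro A B h
    simp only [bangN, Ty.bang.injEq] at h
    exact ih h

/-! ### Splitting contexts -/

/-- `Δ` is covered by `Γ₁` and `Γ₂`, which share only variables of type `!B`. -/
def Split (Δ Γ₁ Γ₂ : Ctx) : Prop := ∀ x,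
  (Γ₁ x = Δ x ∧ Γ₂ x = none) ∨ (Γ₁ x = none ∧ Γ₂ x = Δ x) ∨
    (Γ₁ x = Δ x ∧ Γ₂ x = Δ x ∧ ∃ B, Δ x = some (.bang B))

theorem Split.symm {Δ Γ₁ Γ₂ : Ctx} (h : Split Δ Γ₁ Γ₂) : Split Δ Γ₂ Γ₁ := by
  intro x
  have := h x
  tauto

theorem Split.eq_none {Δ Γ₁ Γ₂ : Ctx} (h : Split Δ Γ₁ Γ₂) {x : ℕ} (hx : Δ x = none) :
    Γ₁ x = none ∧ Γ₂ x = none := by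
  have := h x
  simp only [hx] at this
  tauto

theorem Split.extC_right {Δ Γ₁ Γ₂ : Ctx} (h : Split Δ Γ₁ Γ₂) {x : ℕ} (hx : Δ x = none) (A : Ty) :
    Split (extC Δ x A) Γ₁ (extC Γ₂ x A) := by
  intro y
  by_cases hy : y = x
  · subst hy
    simp [extC, (h.eq_none hx).1]
  · simpa [extC, hy] using h y

theorem Split.right (Δ : Ctx) : Split Δ Δ emptyC := fun _ => .inl ⟨rfl, rfl⟩

theorem split_of_unionC {Δ Γ₁ Γ₂ : Ctx} (hΔ : IsBangC Δ) (h₁₂ : DisjC Γ₁ Γ₂) (h₁ : DisjC Γ₁ Δ)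
    (h₂ : DisjC Γ₂ Δ) :
    Split (unionC Γ₁ (unionC Γ₂ Δ)) (unionC Γ₁ Δ) (unionC Γ₂ Δ) := by
  intro x
  have a := hΔ x
  have b := h₁₂ x
  have c := h₁ x
  have d := h₂ x
  unfold unionC
  cases e₁ : Γ₁ x <;> cases e₂ : Γ₂ x <;> cases e₃ : Δ x <;> simp_all

theorem Split.exists_unionC {Δ Γ₁ Γ₂ : Ctx} (h : Split Δ Γ₁ Γ₂) :
    ∃ D G₁ G₂ : Ctx, IsBangC D ∧ DisjC G₁ G₂ ∧ DisjC G₁ D ∧ DisjC G₂ D ∧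
      unionC G₁ D = Γ₁ ∧ unionC G₂ D = Γ₂ ∧ unionC G₁ (unionC G₂ D) = Δ := by
  refine ⟨fun x => if Γ₁ x = none ∨ Γ₂ x = none then none else Δ x,
    fun x => if Γ₂ x = none then Γ₁ x else none,
    fun x => if Γ₁ x = none then Γ₂ x else none, ?_, ?_, ?_, ?_, ?_, ?_, ?_⟩
  all_goals
    first
    | intro x
    | funext x
    have hx := h x
    simp only [unionC]
    cases e₁ : Γ₁ x <;> cases e₂ : Γ₂ x <;> cases e₃ : Δ x <;> simp_all

/-! ### Typing rules and inversion in terms of `Split` -/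

variable {cty : ℕ → Ty}

theorem Typing.var_single (x : ℕ) (A : Ty) : Typing cty (extC emptyC x A) (.var x A) A :=
  .var (fun _ _ h => by cases h) rfl (.refl A)

theorem Typing.app_split {Δ Γ₁ Γ₂ : Ctx} {M N : Tm} {A B : Ty} (h : Split Δ Γ₁ Γ₂)
    (hM : Typing cty Γ₁ M (.arrow A B)) (hN : Typing cty Γ₂ N A) :
    Typing cty Δ (.app M N) B := by
  obtain ⟨D, G₁, G₂, hD, h₁₂, h₁, h₂, rfl, rfl, rfl⟩ := h.exists_unionC
  exact .app hD h₁₂ h₁ h₂ hM hN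

theorem Typing.pair_split {Δ Γ₁ Γ₂ : Ctx} {n : ℕ} {M N : Tm} {A B : Ty} (h : Split Δ Γ₁ Γ₂)
    (hM : Typing cty Γ₁ M (bangN n A)) (hN : Typing cty Γ₂ N (bangN n B)) :
    Typing cty Δ (.pair n M N) (bangN n (.tensor A B)) := by
  obtain ⟨D, G₁, G₂, hD, h₁₂, h₁, h₂, rfl, rfl, rfl⟩ := h.exists_unionC
  exact .pair hD h₁₂ h₁ h₂ hM hN

theorem Typing.letv_split {Δ Γ₁ Γ₂ : Ctx} {x : ℕ} {M N : Tm} {A B : Ty} (h : Split Δ Γ₁ Γ₂)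
    (hx : Δ x = none) (hM : Typing cty Γ₁ M A) (hN : Typing cty (extC Γ₂ x A) N B) :
    Typing cty Δ (.letv x A M N) B := by
  obtain ⟨D, G₁, G₂, hD, h₁₂, h₁, h₂, rfl, rfl, rfl⟩ := h.exists_unionC
  exact .letv hD h₁₂ h₁ h₂ hx hM hN

theorem Typing.letUnit_split {Δ Γ₁ Γ₂ : Ctx} {M N : Tm} {A : Ty} (h : Split Δ Γ₁ Γ₂)
    (hM : Typing cty Γ₁ M .unit) (hN : Typing cty Γ₂ N A) :
    Typing cty Δ (.letUnit M N) A := by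
  obtain ⟨D, G₁, G₂, hD, h₁₂, h₁, h₂, rfl, rfl, rfl⟩ := h.exists_unionC
  exact .letUnit hD h₁₂ h₁ h₂ hM hN

theorem Typing.letPair_split {Δ Γ₁ Γ₂ : Ctx} {n x y : ℕ} {M N : Tm} {A B C : Ty}
    (h : Split Δ Γ₁ Γ₂) (hxy : x ≠ y) (hx : Δ x = none) (hy : Δ y = none)
    (hM : Typing cty Γ₁ M (bangN n (.tensor A B)))
    (hN : Typing cty (extC (extC Γ₂ x (bangN n A)) y (bangN n B)) N C) :
    Typing cty Δ (.letPair n x A y B M N) C := by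
  obtain ⟨D, G₁, G₂, hD, h₁₂, h₁, h₂, rfl, rfl, rfl⟩ := h.exists_unionC
  exact .letPair hD h₁₂ h₁ h₂ hxy hx hy hM hN

theorem Typing.app_inv {Δ : Ctx} {M N : Tm} {B : Ty} (h : Typing cty Δ (.app M N) B) :
    ∃ Γ₁ Γ₂ A, Split Δ Γ₁ Γ₂ ∧ Typing cty Γ₁ M (.arrow A B) ∧ Typing cty Γ₂ N A := by
  cases h with
  | app hD h₁₂ h₁ h₂ hM hN => exact ⟨_, _, _, split_of_unionC hD h₁₂ h₁ h₂, hM, hN⟩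

theorem Typing.pair_inv {Δ : Ctx} {n : ℕ} {M N : Tm} {A B : Ty}
    (h : Typing cty Δ (.pair n M N) (bangN n (.tensor A B))) :
    ∃ Γ₁ Γ₂, Split Δ Γ₁ Γ₂ ∧ Typing cty Γ₁ M (bangN n A) ∧ Typing cty Γ₂ N (bangN n B) := by
  generalize hT : bangN n (.tensor A B) = T at h
  cases h with
  | pair hD h₁₂ h₁ h₂ hM hN =>
    obtain ⟨rfl, rfl⟩ := Ty.tensor.inj (bangN_injective n hT)
    exact ⟨_, _, split_of_unionC hD h₁₂ h₁ h₂, hM, hN⟩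

/-- The variables bound by a `let` pattern. -/
def LetPat.vars : LetPat → Finset ℕ
  | .pvar x _ => {x}
  | .punit => ∅
  | .ppair _ x _ y _ => {x, y}

/-- The body of a well-typed `let` can be replaced by any term of the same type. -/
theorem Typing.mkLet_inv {Δ : Ctx} {p : LetPat} {M N : Tm} {T : Ty}
    (h : Typing cty Δ (mkLet p M N) T) :
    ∃ Γ₁ S Γ₂, Typing cty Γ₁ M S ∧ Typing cty Γ₂ N T ∧
      (∀ z, z ∉ p.vars → Δ z = none → Γ₂ z = none) ∧
      ∀ N', Typing cty Γ₂ N' T → Typing cty Δ (mkLet p M N') T := by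
  cases p with
  | pvar x A =>
    cases h with
    | letv hD h₁₂ h₁ h₂ hx hM hN =>
      refine ⟨_, _, _, hM, hN, fun z hz hΔ => ?_, fun N' hN' => .letv hD h₁₂ h₁ h₂ hx hM hN'⟩
      have := (split_of_unionC hD h₁₂ h₁ h₂).eq_none hΔ
      simp_all [LetPat.vars, extC]
  | punit =>
    cases h with
    | letUnit hD h₁₂ h₁ h₂ hM hN =>
      exact ⟨_, _, _, hM, hN, fun z _ hΔ => ((split_of_unionC hD h₁₂ h₁ h₂).eq_none hΔ).2,
        fun N' hN' => .letUnit hD h₁₂ h₁ h₂ hM hN'⟩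
  | ppair n x A y B =>
    cases h with
    | letPair hD h₁₂ h₁ h₂ hxy hx hy hM hN =>
      refine ⟨_, _, _, hM, hN, fun z hz hΔ => ?_,
        fun N' hN' => .letPair hD h₁₂ h₁ h₂ hxy hx hy hM hN'⟩
      have := (split_of_unionC hD h₁₂ h₁ h₂).eq_none hΔ
      simp_all [LetPat.vars, extC]

/-- An indexed term determines its type. -/
theorem Typing.unique {Δ Δ' : Ctx} {M : Tm} {A A' : Ty} (h : Typing cty Δ M A)
    (h' : Typing cty Δ' M A') : A = A' := by
  induction h generalizing Δ' A' with
  | var => cases h'; rfl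
  | cst => cases h'; rfl
  | star => cases h'; rfl
  | lam0 _ _ ih => cases h' with | lam0 _ h => rw [ih h]
  | lamS _ _ _ ih => cases h' with | lamS _ _ h => rw [ih h]
  | app _ _ _ _ _ _ ih _ =>
    cases h' with | app _ _ _ _ h _ => exact (Ty.arrow.inj (ih h)).2
  | pair _ _ _ _ _ _ ih₁ ih₂ =>
    cases h' with
    | pair _ _ _ _ h₁ h₂ => rw [bangN_injective _ (ih₁ h₁), bangN_injective _ (ih₂ h₂)]
  | letv _ _ _ _ _ _ _ _ ih => cases h' with | letv _ _ _ _ _ _ h => exact ih h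
  | letUnit _ _ _ _ _ _ _ ih => cases h' with | letUnit _ _ _ _ _ h => exact ih h
  | letPair _ _ _ _ _ _ _ _ _ _ ih =>
    cases h' with | letPair _ _ _ _ _ _ _ _ h => exact ih h

/-- Substituting for a variable outside the typing context does nothing. -/
theorem Typing.psubst_erase {Δ : Ctx} {M : Tm} {A : Ty} (h : Typing cty Δ M A) {x : ℕ}
    (hx : Δ x = none) (V : PTm) : psubst x V (erase M) = erase M := by
  induction h with
  | @var Δ z A B _ _ _ =>
    have : z ≠ x := by rintro rfl; simp [extC] at hx
    simp [erase, psubst, this]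
  | cst => rfl
  | star => rfl
  | @lam0 Δ z _ _ _ _ _ ih | @lamS Δ _ z _ _ _ _ _ _ ih =>
    by_cases hz : z = x
    · simp [erase, psubst, hz]
    · simp [erase, psubst, hz, ih (by simp [extC, hx, Ne.symm hz])]
  | app hD h₁₂ h₁ h₂ _ _ ih₁ ih₂ | pair hD h₁₂ h₁ h₂ _ _ ih₁ ih₂
  | letUnit hD h₁₂ h₁ h₂ _ _ ih₁ ih₂ =>
    have := (split_of_unionC hD h₁₂ h₁ h₂).eq_none hx
    simp [erase, psubst, ih₁ this.1, ih₂ this.2]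
  | @letv _ _ _ z _ _ _ _ hD h₁₂ h₁ h₂ _ _ _ ih₁ ih₂ =>
    have := (split_of_unionC hD h₁₂ h₁ h₂).eq_none hx
    by_cases hz : z = x
    · simp [erase, psubst, ih₁ this.1, hz]
    · simp [erase, psubst, ih₁ this.1, hz, ih₂ (by simp [extC, this.2, Ne.symm hz])]
  | @letPair _ _ _ _ z _ w _ _ _ _ hD h₁₂ h₁ h₂ _ _ _ _ _ ih₁ ih₂ =>
    have := (split_of_unionC hD h₁₂ h₁ h₂).eq_none hx
    by_cases hz : z = x ∨ w = x
    · simp [erase, psubst, ih₁ this.1, hz]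
    · rw [not_or] at hz
      simp [erase, psubst, ih₁ this.1, hz.1, hz.2,
        ih₂ (by simp [extC, this.2, Ne.symm hz.1, Ne.symm hz.2])]

/-! ### Restricting contexts to finitely many variables -/

/-- The restriction of a context to a finite set of variables. -/
def restrictC (S : Finset ℕ) (Δ : Ctx) : Ctx := fun x => if x ∈ S then Δ x else none

theorem restrictC_extC {S : Finset ℕ} (Δ : Ctx) {x : ℕ} (hx : x ∈ S) (A : Ty) :
    restrictC S (extC Δ x A) = extC (restrictC S Δ) x A := by
  funext y
  by_cases hy : y = x <;> simp [restrictC, extC, hy, hx]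

theorem restrictC_eq_none {Δ : Ctx} {x : ℕ} (S : Finset ℕ) (hx : Δ x = none) :
    restrictC S Δ x = none := by
  simp [restrictC, hx]

theorem IsBangC.restrictC {Δ : Ctx} (h : IsBangC Δ) (S : Finset ℕ) : IsBangC (restrictC S Δ) := by
  intro x A hA
  unfold QLam.restrictC at hA
  split at hA
  · exact h x A hA
  · cases hA

theorem Split.restrictC {Δ Γ₁ Γ₂ : Ctx} (h : Split Δ Γ₁ Γ₂) (S : Finset ℕ) :
    Split (restrictC S Δ) (restrictC S Γ₁) (restrictC S Γ₂) := by
  intro x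
  by_cases hx : x ∈ S
  · simpa [QLam.restrictC, hx] using h x
  · simp [QLam.restrictC, hx]

/-- Only finitely many variables of a context matter for a typing judgment. -/
theorem Typing.exists_restrictC {Δ : Ctx} {M : Tm} {A : Ty} (h : Typing cty Δ M A) :
    ∃ S : Finset ℕ, ∀ S', S ⊆ S' → Typing cty (restrictC S' Δ) M A := by
  induction h with
  | @var Δ x A B hΔ hx hAB =>
    refine ⟨{x}, fun S' hS => ?_⟩
    rw [restrictC_extC Δ (by simpa using hS)]
    exact .var (hΔ.restrictC S') (restrictC_eq_none S' hx) hAB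
  | cst hΔ hB => exact ⟨∅, fun S' _ => .cst (hΔ.restrictC S') hB⟩
  | star hΔ => exact ⟨∅, fun S' _ => .star (hΔ.restrictC S')⟩
  | @lam0 Δ x A M B hx _ ih =>
    obtain ⟨S, hS⟩ := ih
    refine ⟨insert x S, fun S' h => ?_⟩
    rw [Finset.insert_subset_iff] at h
    exact .lam0 (restrictC_eq_none S' hx) (restrictC_extC Δ h.1 A ▸ hS S' h.2)
  | @lamS Δ n x A M B hΔ hx _ ih =>
    obtain ⟨S, hS⟩ := ih
    refine ⟨insert x S, fun S' h => ?_⟩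
    rw [Finset.insert_subset_iff] at h
    exact .lamS (hΔ.restrictC S') (restrictC_eq_none S' hx)
      (restrictC_extC Δ h.1 A ▸ hS S' h.2)
  | app hD h₁₂ h₁ h₂ _ _ ih₁ ih₂ =>
    obtain ⟨S₁, hS₁⟩ := ih₁
    obtain ⟨S₂, hS₂⟩ := ih₂
    refine ⟨S₁ ∪ S₂, fun S' h => ?_⟩
    rw [Finset.union_subset_iff] at h
    exact .app_split ((split_of_unionC hD h₁₂ h₁ h₂).restrictC S') (hS₁ S' h.1) (hS₂ S' h.2)
  | pair hD h₁₂ h₁ h₂ _ _ ih₁ ih₂ =>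
    obtain ⟨S₁, hS₁⟩ := ih₁
    obtain ⟨S₂, hS₂⟩ := ih₂
    refine ⟨S₁ ∪ S₂, fun S' h => ?_⟩
    rw [Finset.union_subset_iff] at h
    exact .pair_split ((split_of_unionC hD h₁₂ h₁ h₂).restrictC S') (hS₁ S' h.1) (hS₂ S' h.2)
  | letUnit hD h₁₂ h₁ h₂ _ _ ih₁ ih₂ =>
    obtain ⟨S₁, hS₁⟩ := ih₁
    obtain ⟨S₂, hS₂⟩ := ih₂
    refine ⟨S₁ ∪ S₂, fun S' h => ?_⟩
    rw [Finset.union_subset_iff] at h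
    exact .letUnit_split ((split_of_unionC hD h₁₂ h₁ h₂).restrictC S') (hS₁ S' h.1) (hS₂ S' h.2)
  | @letv _ _ _ x A _ _ _ hD h₁₂ h₁ h₂ hx _ _ ih₁ ih₂ =>
    obtain ⟨S₁, hS₁⟩ := ih₁
    obtain ⟨S₂, hS₂⟩ := ih₂
    refine ⟨insert x (S₁ ∪ S₂), fun S' h => ?_⟩
    rw [Finset.insert_subset_iff, Finset.union_subset_iff] at h
    exact .letv_split ((split_of_unionC hD h₁₂ h₁ h₂).restrictC S') (restrictC_eq_none S' hx)
      (hS₁ S' h.2.1) (restrictC_extC _ h.1 A ▸ hS₂ S' h.2.2)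
  | @letPair _ _ _ n x A y B _ _ _ hD h₁₂ h₁ h₂ hxy hx hy _ _ ih₁ ih₂ =>
    obtain ⟨S₁, hS₁⟩ := ih₁
    obtain ⟨S₂, hS₂⟩ := ih₂
    refine ⟨insert x (insert y (S₁ ∪ S₂)), fun S' h => ?_⟩
    rw [Finset.insert_subset_iff, Finset.insert_subset_iff, Finset.union_subset_iff] at h
    have := hS₂ S' h.2.2.2
    rw [restrictC_extC _ h.2.1, restrictC_extC _ h.1] at this
    exact .letPair_split ((split_of_unionC hD h₁₂ h₁ h₂).restrictC S') hxy
      (restrictC_eq_none S' hx) (restrictC_eq_none S' hy) (hS₁ S' h.2.2.1) this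

/-! ### Properties of axiomatic equivalence -/

theorem AxEq.typing_right {Δ : Ctx} {M N : Tm} {A : Ty} (h : AxEq cty Δ M N A) :
    Typing cty Δ N A := by
  have key : Typing cty Δ M A ∧ Typing cty Δ N A := by
    induction h with
    | refl h => exact ⟨h, h⟩
    | symm _ ih => exact ih.symm
    | trans _ _ ih₁ ih₂ => exact ⟨ih₁.1, ih₂.2⟩
    | _ => exact ⟨by assumption, by assumption⟩
  exact key.2

theorem Typing.letUnit_star {Δ : Ctx} {M : Tm} {A : Ty} (h : Typing cty Δ M A) :
    Typing cty Δ (.letUnit (.star 0) M) A :=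
  .letUnit_split (Split.right Δ).symm (.star (n := 0) fun _ _ h => by cases h) h

/-- Equivalence does not depend on the context in which it is derived. -/
theorem AxEq.change_ctx {Δ Δ' : Ctx} {M N : Tm} {A A' : Ty} (h : AxEq cty Δ' M N A')
    (hM : Typing cty Δ M A) (hN : Typing cty Δ N A) : AxEq cty Δ M N A :=
  .trans (.symm (.beta_letUnit hM.letUnit_star hM))
    (.trans (.congLetUnit (.refl (Δ := emptyC) (.star (n := 0) fun _ _ h => by cases h)) h
      hM.letUnit_star hN.letUnit_star) (.beta_letUnit hN.letUnit_star hN))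

theorem AxEq.congMkLet {p : LetPat} {Δ Δ₁ Δ₂ : Ctx} {M N N' : Tm} {S T A : Ty}
    (hM : Typing cty Δ₁ M S) (h : AxEq cty Δ₂ N N' T)
    (hN : Typing cty Δ (mkLet p M N) A) (hN' : Typing cty Δ (mkLet p M N') A) :
    AxEq cty Δ (mkLet p M N) (mkLet p M N') A := by
  cases p with
  | pvar x B => exact .congLetv x B (.refl hM) h hN hN'
  | punit => exact .congLetUnit (.refl hM) h hN hN'
  | ppair n x B y C => exact .congLetPair n x B y C (.refl hM) h hN hN'

/-- If the hole of `K` can be named by a fresh variable, then `let`s can be pulled out of it. -/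
theorem AxEq.pull_let {K : Tm → Tm} {R T : Ty}
    (hK : ∀ Γ P y z, Typing cty Γ (K P) T → y ≠ z → Γ y = none → Γ z = none →
      AxEq cty Γ (K P) (.letv y R P (K (.var y R))) T)
    {Δ : Ctx} {p : LetPat} {M N : Tm} (h₁ : Typing cty Δ (K (mkLet p M N)) T)
    (h₂ : Typing cty Δ (mkLet p M (K N)) T) :
    AxEq cty Δ (K (mkLet p M N)) (mkLet p M (K N)) T := by
  obtain ⟨S₁, hS₁⟩ := h₁.exists_restrictC
  obtain ⟨S₂, hS₂⟩ := h₂.exists_restrictC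
  have r₁ := hS₁ (S₁ ∪ S₂) Finset.subset_union_left
  have r₂ := hS₂ (S₁ ∪ S₂) Finset.subset_union_right
  have fresh : ∀ w, w ∉ S₁ ∪ S₂ → restrictC (S₁ ∪ S₂) Δ w = none :=
    fun w hw => by simp only [restrictC, if_neg hw]
  refine AxEq.change_ctx (Δ' := restrictC (S₁ ∪ S₂) Δ) (A' := T) ?_ h₁ h₂
  generalize restrictC (S₁ ∪ S₂) Δ = Γ at *
  obtain ⟨y, hy⟩ := Infinite.exists_notMem_finset (S₁ ∪ S₂ ∪ p.vars)
  obtain ⟨z, hz⟩ := Infinite.exists_notMem_finset (insert y (S₁ ∪ S₂ ∪ p.vars))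
  rw [Finset.mem_union, not_or] at hy
  rw [Finset.mem_insert, Finset.mem_union, not_or, not_or] at hz
  have hyz : y ≠ z := Ne.symm hz.1
  obtain ⟨Γ₁, S, Γ₂, hM, hN, hΓ₂, hrep⟩ := r₂.mkLet_inv
  have e₁ := hK Γ _ y z r₁ hyz (fresh y hy.1) (fresh z hz.2.1)
  have e₂ := hK Γ₂ _ y z hN hyz (hΓ₂ y hy.2 (fresh y hy.1)) (hΓ₂ z hz.2.2 (fresh z hz.2.1))
  have t := hrep _ e₂.typing_right
  exact .trans e₁ (.trans (.letassoc (.pvar y R) p M N _ e₁.typing_right t)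
    (.congMkLet hM (.symm e₂) t r₂))

/-! ### Binary term formers -/

/-- The features shared by application and pairing at fixed types. -/
structure IsBinary (cty : ℕ → Ty) (op : Tm → Tm → Tm) (T₁ T₂ T : Ty) : Prop where
  typing : ∀ {Δ Γ₁ Γ₂ M N}, Split Δ Γ₁ Γ₂ → Typing cty Γ₁ M T₁ → Typing cty Γ₂ N T₂ →
    Typing cty Δ (op M N) T
  subst : ∀ {x V M N M' N'}, erase M' = psubst x V (erase M) → erase N' = psubst x V (erase N) →
    erase (op M' N') = psubst x V (erase (op M N))
  letop : ∀ {Δ x y M N},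
    Typing cty Δ (.letv x T₁ M (.letv y T₂ N (op (.var x T₁) (.var y T₂)))) T →
    Typing cty Δ (op M N) T →
    AxEq cty Δ (.letv x T₁ M (.letv y T₂ N (op (.var x T₁) (.var y T₂)))) (op M N) T

theorem isBinary_app (A B : Ty) : IsBinary cty .app (.arrow A B) A B where
  typing := .app_split
  subst h₁ h₂ := by simp [erase, psubst, h₁, h₂]
  letop := .letapp

theorem isBinary_pair (n : ℕ) (A B : Ty) :
    IsBinary cty (.pair n) (bangN n A) (bangN n B) (bangN n (.tensor A B)) where
  typing := .pair_split
  subst h₁ h₂ := by simp [erase, psubst, h₁, h₂]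
  letop := .lettens

namespace IsBinary

variable {op : Tm → Tm → Tm} {T₁ T₂ T : Ty}

theorem typing_vars (hop : IsBinary cty op T₁ T₂ T) {x y : ℕ} (hxy : x ≠ y) :
    Typing cty (extC (extC emptyC x T₁) y T₂) (op (.var x T₁) (.var y T₂)) T :=
  hop.typing ((Split.right _).extC_right (by simp [extC, emptyC, hxy.symm]) T₂)
    (.var_single x T₁) (.var_single y T₂)

/-- The right argument of a term former applied to a value can be named. -/
theorem name_right (hop : IsBinary cty op T₁ T₂ T) {Γ Γ₁ Γ₂ : Ctx} {V P : Tm} {y z : ℕ}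
    (hV : IsValue V) (hs : Split Γ Γ₁ Γ₂)
    (tV : Typing cty Γ₁ V T₁) (tP : Typing cty Γ₂ P T₂)
    (hyz : y ≠ z) (hy : Γ y = none) (hz : Γ z = none) :
    AxEq cty Γ (op V P) (.letv y T₂ P (op V (.var y T₂))) T := by
  have hy' := hs.eq_none hy
  have hz' := hs.eq_none hz
  have t₁ : Typing cty (extC Γ₁ y T₂) (op V (.var y T₂)) T :=
    hop.typing ((Split.right Γ₁).extC_right hy'.1 T₂) tV (.var_single y T₂)
  have t₂ : Typing cty (extC Γ₂ z T₁)
      (.letv y T₂ P (op (.var z T₁) (.var y T₂))) T :=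
    .letv_split ((Split.right Γ₂).extC_right hz'.2 T₁) (by simp [extC, hyz, hy'.2]) tP
      (hop.typing_vars hyz.symm)
  have t₃ := Typing.letv_split hs hz tV t₂
  refine .trans (.symm (hop.letop t₃ (hop.typing hs tV tP)))
    (.beta_letv hV t₃ (.letv_split hs.symm hy tP t₁) ?_)
  have e : erase (op V (.var y T₂)) =
      psubst z (erase V) (erase (op (.var z T₁) (.var y T₂))) :=
    hop.subst (by simp [erase, psubst]) (by simp [erase, psubst, hyz])
  simp [erase, psubst, hyz, e, tP.psubst_erase hz'.2]

/-- The left argument of a term former applied to a value can be named. -/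
theorem name_left (hop : IsBinary cty op T₁ T₂ T) {Γ Γ₁ Γ₂ : Ctx} {V P : Tm} {y z : ℕ}
    (hV : IsValue V) (hs : Split Γ Γ₁ Γ₂)
    (tP : Typing cty Γ₁ P T₁) (tV : Typing cty Γ₂ V T₂)
    (hyz : y ≠ z) (hy : Γ y = none) (hz : Γ z = none) :
    AxEq cty Γ (op P V) (.letv y T₁ P (op (.var y T₁) V)) T := by
  have hy' := hs.eq_none hy
  have hz' := hs.eq_none hz
  have sy : Split (extC Γ₂ y T₁) Γ₂ (extC emptyC y T₁) := (Split.right Γ₂).extC_right hy'.2 T₁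
  have t₁ : Typing cty (extC Γ₂ y T₁) (op (.var y T₁) V) T :=
    hop.typing sy.symm (.var_single y T₁) tV
  have t₂ : Typing cty (extC Γ₂ y T₁)
      (.letv z T₂ V (op (.var y T₁) (.var z T₂))) T :=
    .letv_split sy (by simp [extC, hyz.symm, hz'.2]) tV (hop.typing_vars hyz)
  have t₃ := Typing.letv_split hs hy tP t₂
  refine .trans (.symm (hop.letop t₃ (hop.typing hs tP tV)))
    (.congLetv y T₁ (.refl tP) (.beta_letv hV t₂ t₁ ?_) t₃ (.letv_split hs hy tP t₁))
  exact hop.subst (by simp [erase, psubst, hyz]) (by simp [erase, psubst])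

end IsBinary

/-- **derived equivalences.** The following equivalences are derivable
from the axioms of Table 2 whenever both sides are well-typed (`−` is a placeholder
for `x`, `∗`, or `⟨x,y⟩`, described by a `LetPat`):
(i) `Δ,x:A ⊢ let y^A = x^A in M ≈ M[x/y] : B`;
(ii) `!Δ ⊢ let x^{!C} = V in λ^{n+1}y.M ≈ λ^{n+1}y. let x^{!C} = V in M : !^{n+1}(A⊸B)`;
(iii) `Δ ⊢ ⟨V, let − = M in N⟩ ≈ let − = M in ⟨V,N⟩ : !ⁿ(A⊗B)`;
(iv) `Δ ⊢ ⟨let − = M in N, V⟩ ≈ let − = M in ⟨N,V⟩ : !ⁿ(A⊗B)`;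
(v) `Δ ⊢ V(let − = M in N) ≈ let − = M in VN : B`;
(vi) `Δ ⊢ (let − = M in N)V ≈ let − = M in NV : B`. -/
theorem derived_equivalences (cty : ℕ → Ty) :
    -- (i)  (ax_alet): renaming of a context variable
    (∀ (Δ : Ctx) (x : ℕ) (A : Ty) (y : ℕ) (M S : Tm) (B : Ty),
      Typing cty (extC Δ x A) (.letv y A (.var x A) M) B →
      Typing cty (extC Δ x A) S B →
      erase S = psubst y (.var x) (erase M) →
      AxEq cty (extC Δ x A) (.letv y A (.var x A) M) S B) ∧
    -- (ii)  (ax_oletlambB)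
    (∀ (Δ : Ctx) (x : ℕ) (C : Ty) (V : Tm) (n y : ℕ) (A : Ty) (M : Tm) (B : Ty),
      IsBangC Δ → IsValue V →
      Typing cty Δ (.letv x (.bang C) V (.lam (n+1) y A M)) (bangN (n+1) (.arrow A B)) →
      Typing cty Δ (.lam (n+1) y A (.letv x (.bang C) V M)) (bangN (n+1) (.arrow A B)) →
      AxEq cty Δ (.letv x (.bang C) V (.lam (n+1) y A M))
        (.lam (n+1) y A (.letv x (.bang C) V M)) (bangN (n+1) (.arrow A B))) ∧
    -- (iii)  (ax_olettensB)
    (∀ (Δ : Ctx) (p : LetPat) (V M N : Tm) (n : ℕ) (A B : Ty),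
      IsValue V →
      Typing cty Δ (.pair n V (mkLet p M N)) (bangN n (.tensor A B)) →
      Typing cty Δ (mkLet p M (.pair n V N)) (bangN n (.tensor A B)) →
      AxEq cty Δ (.pair n V (mkLet p M N)) (mkLet p M (.pair n V N)) (bangN n (.tensor A B))) ∧
    -- (iv)  (ax_olettensA)
    (∀ (Δ : Ctx) (p : LetPat) (V M N : Tm) (n : ℕ) (A B : Ty),
      IsValue V →
      Typing cty Δ (.pair n (mkLet p M N) V) (bangN n (.tensor A B)) →
      Typing cty Δ (mkLet p M (.pair n N V)) (bangN n (.tensor A B)) →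
      AxEq cty Δ (.pair n (mkLet p M N) V) (mkLet p M (.pair n N V)) (bangN n (.tensor A B))) ∧
    -- (v)  (ax_oletapp)
    (∀ (Δ : Ctx) (p : LetPat) (V M N : Tm) (B : Ty),
      IsValue V →
      Typing cty Δ (.app V (mkLet p M N)) B →
      Typing cty Δ (mkLet p M (.app V N)) B →
      AxEq cty Δ (.app V (mkLet p M N)) (mkLet p M (.app V N)) B) ∧
    -- (vi)  (ax_oletappA)
    (∀ (Δ : Ctx) (p : LetPat) (V M N : Tm) (B : Ty),
      IsValue V →
      Typing cty Δ (.app (mkLet p M N) V) B →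
      Typing cty Δ (mkLet p M (.app N V)) B →
      AxEq cty Δ (.app (mkLet p M N) V) (mkLet p M (.app N V)) B) := by
  refine ⟨?_, ?_, ?_, ?_, ?_, ?_⟩
  · intro Δ x A y M S B h₁ h₂ hS
    exact .beta_letv (.core (.var x A)) h₁ h₂ hS
  · intro Δ x C V n y A M B _ hV h₁ h₂
    exact .letlam hV h₁ h₂
  · intro Δ p V M N n A B hV h₁ h₂
    refine AxEq.pull_let (K := .pair n V) (R := bangN n B) ?_ h₁ h₂
    intro Γ P y z h hyz hy hz
    obtain ⟨Γ₁, Γ₂, hs, tV, tP⟩ := h.pair_inv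
    exact (isBinary_pair n A B).name_right hV hs tV tP hyz hy hz
  · intro Δ p V M N n A B hV h₁ h₂
    refine AxEq.pull_let (K := fun P => .pair n P V) (R := bangN n A) ?_ h₁ h₂
    intro Γ P y z h hyz hy hz
    obtain ⟨Γ₁, Γ₂, hs, tP, tV⟩ := h.pair_inv
    exact (isBinary_pair n A B).name_left hV hs tP tV hyz hy hz
  · intro Δ p V M N B hV h₁ h₂
    obtain ⟨_, _, A, _, tV, _⟩ := h₁.app_inv
    refine AxEq.pull_let (K := .app V) (R := A) ?_ h₁ h₂
    intro Γ P y z h hyz hy hz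
    obtain ⟨Γ₁, Γ₂, A', hs, tV', tP⟩ := h.app_inv
    obtain ⟨rfl, -⟩ := Ty.arrow.inj (tV.unique tV')
    exact (isBinary_app A B).name_right hV hs tV' tP hyz hy hz
  · intro Δ p V M N B hV h₁ h₂
    obtain ⟨_, _, A, _, _, tV⟩ := h₁.app_inv
    refine AxEq.pull_let (K := fun P => .app P V) (R := .arrow A B) ?_ h₁ h₂
    intro Γ P y z h hyz hy hz
    obtain ⟨Γ₁, Γ₂, A', hs, tP, tV'⟩ := h.app_inv
    obtain rfl := tV.unique tV'
    exact (isBinary_app A B).name_left hV hs tP tV' hyz hy hz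

end QLam
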